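/- arXiv:2503.20203 — 4 statements merged into one kernel-verified Lean document; each statement's English description precedes it below -/
import Mathlib

section
/- Let u and v be unit vectors in ℂ³. Then ‖R_u − R_v‖_F ≤ 2√2 · ‖u − v‖ · sqrt(1 − ‖u − v‖²/4), where ‖u − v‖ is the Euclidean (ℓ²) norm of the vector u − v. -/
open scoped ComplexConjugate

/-- Frobenius norm of a 3×3 complex matrix. -/
noncomputable def frobNorm (A : Matrix (Fin 3) (Fin 3) ℂ) : ℝ :=
  Real.sqrt (∑ i, ∑ j, ‖A i j‖ ^ 2)

/-- Householder reflection `I - 2 w w†` associated to a vector `w ∈ ℂ³`. -/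
noncomputable def householder (w : EuclideanSpace ℂ (Fin 3)) : Matrix (Fin 3) (Fin 3) ℂ :=
  1 - (2 : ℂ) • Matrix.of (fun i j => w i * conj (w j))

/-- The squared Frobenius distance of two Householder reflections, before normalising `u`, `v`. -/
lemma sum_norm_sq_householder_sub (u v : EuclideanSpace ℂ (Fin 3)) :
    ∑ i, ∑ j, ‖(householder u - householder v) i j‖ ^ 2
      = 4 * ((‖u‖ ^ 2) ^ 2 + (‖v‖ ^ 2) ^ 2 - 2 * Complex.normSq (inner ℂ u v)) := by
  simp only [EuclideanSpace.norm_sq_eq, PiLp.inner_apply, Fin.sum_univ_three,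
    ← Complex.normSq_eq_norm_sq, householder, Matrix.sub_apply, Matrix.smul_apply,
    Matrix.of_apply, sub_sub_sub_cancel_left, smul_eq_mul, ← mul_sub, Complex.normSq_mul,
    RCLike.inner_apply]
  simp only [Complex.normSq_apply, Complex.add_re, Complex.add_im, Complex.sub_re,
    Complex.sub_im, Complex.mul_re, Complex.mul_im, Complex.conj_re, Complex.conj_im,
    Complex.re_ofNat, Complex.im_ofNat]
  ring

theorem frobNorm_householder_sub_le (u v : EuclideanSpace ℂ (Fin 3))
    (hu : ‖u‖ = 1) (hv : ‖v‖ = 1) :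
    frobNorm (householder u - householder v)
      ≤ 2 * Real.sqrt 2 * ‖u - v‖ * Real.sqrt (1 - ‖u - v‖ ^ 2 / 4) := by
  have hre : ‖u - v‖ ^ 2 = 2 * (1 - (inner ℂ u v).re) := by
    have h := norm_sub_sq (𝕜 := ℂ) u v
    simp only [hu, hv, RCLike.re_to_complex] at h
    linarith
  have hnormSq : (inner ℂ u v).re ^ 2 ≤ Complex.normSq (inner ℂ u v) := by
    rw [Complex.normSq_apply]
    nlinarith [sq_nonneg (inner ℂ u v).im]
  have hle : |(inner ℂ u v).re| ≤ 1 :=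
    (Complex.abs_re_le_norm _).trans (by simpa [hu, hv] using norm_inner_le_norm (𝕜 := ℂ) u v)
  have hnonneg : 0 ≤ 1 - ‖u - v‖ ^ 2 / 4 := by linarith [(abs_le.mp hle).1]
  refine Real.sqrt_le_iff.mpr ⟨by positivity, ?_⟩
  rw [sum_norm_sq_householder_sub, hu, hv, mul_pow, mul_pow, mul_pow, Real.sq_sqrt hnonneg,
    Real.sq_sqrt zero_le_two, hre]
  linarith
end

section
/- Let α, r₁, r₂, p, b be real numbers with cos α ≥ 0, r₁ ≤ r₂, b·sin α ≤ r₁, p·cos α + b·sin α ≥ r₁, and p² + b² ≤ r₂². Then |b − r₁ sin α| ≤ sqrt(r₂² − r₁²) · cos α. -/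
theorem q_range_bound (α r₁ r₂ p b : ℝ)
    (hcos : 0 ≤ Real.cos α) (hr : r₁ ≤ r₂)
    (hb : b * Real.sin α ≤ r₁)
    (hline : r₁ ≤ p * Real.cos α + b * Real.sin α)
    (hdisk : p ^ 2 + b ^ 2 ≤ r₂ ^ 2) :
    |b - r₁ * Real.sin α| ≤ Real.sqrt (r₂ ^ 2 - r₁ ^ 2) * Real.cos α := by
  have hsq : (r₁ - b * Real.sin α) ^ 2 ≤ (p * Real.cos α) ^ 2 :=
    pow_le_pow_left₀ (by linarith) (by linarith) 2
  have hscaled : (p ^ 2 + b ^ 2) * Real.cos α ^ 2 ≤ r₂ ^ 2 * Real.cos α ^ 2 :=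
    mul_le_mul_of_nonneg_right hdisk (sq_nonneg _)
  have hrot : (b - r₁ * Real.sin α) ^ 2
      = b ^ 2 * Real.cos α ^ 2 + (r₁ - b * Real.sin α) ^ 2 - r₁ ^ 2 * Real.cos α ^ 2 := by
    rw [Real.cos_sq']
    ring
  calc |b - r₁ * Real.sin α|
      ≤ Real.sqrt ((r₂ ^ 2 - r₁ ^ 2) * Real.cos α ^ 2) := Real.abs_le_sqrt (by linarith)
    _ = Real.sqrt (r₂ ^ 2 - r₁ ^ 2) * Real.cos α := by
      rw [Real.sqrt_mul' _ (sq_nonneg _), Real.sqrt_sq hcos]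
end

section
/- Let 0 ≤ r₁ ≤ r₂ with r₂ > 0, and let φ = arccos(r₁/r₂). Then the 4-dimensional Lebesgue measure of the hyperspherical cap { y ∈ ℝ⁴ : ‖y‖ ≤ r₂ and y₄ ≥ r₁ } equals (π r₂⁴ / 24) · (12φ − 8 sin(2φ) + sin(4φ)). -/
open scoped Real

/-- The volume of a Euclidean ball in `Fin 3 → ℝ`, as a sublevel set of the sum of squares. -/
lemma volume_sum_sq_le_fin_three {c : ℝ} (hc : 0 ≤ c) :
    MeasureTheory.volume {x : Fin 3 → ℝ | ∑ i, x i ^ 2 ≤ c}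
      = ENNReal.ofReal (4 * π / 3 * √c ^ 3) := by
  have h : {x : Fin 3 → ℝ | ∑ i, x i ^ 2 ≤ c}
      = WithLp.toLp 2 ⁻¹' Metric.closedBall (0 : EuclideanSpace ℝ (Fin 3)) √c := by
    ext x
    simp [EuclideanSpace.norm_eq, Real.sqrt_le_sqrt_iff hc]
  rw [h, (PiLp.volume_preserving_toLp (Fin 3)).measure_preimage
    Metric.isClosed_closedBall.measurableSet.nullMeasurableSet,
    EuclideanSpace.volume_closedBall_fin_three, ← ENNReal.ofReal_pow (Real.sqrt_nonneg _),
    ← ENNReal.ofReal_mul (by positivity)]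
  ring_nf

/-- Slicing a four-dimensional cap by hyperplanes orthogonal to the last axis. -/
lemma volume_cap_eq_integral {r₁ r₂ : ℝ} (h0 : 0 ≤ r₁) (h12 : r₁ ≤ r₂) :
    MeasureTheory.volume {y : EuclideanSpace ℝ (Fin 4) | ‖y‖ ≤ r₂ ∧ r₁ ≤ y 3}
      = ENNReal.ofReal (∫ t in r₁..r₂, 4 * π / 3 * √(r₂ ^ 2 - t ^ 2) ^ 3) := by
  have hr₂ : 0 ≤ r₂ := h0.trans h12
  set T : Set (ℝ × (Fin 3 → ℝ)) := {p | p.1 ^ 2 + ∑ i, p.2 i ^ 2 ≤ r₂ ^ 2 ∧ r₁ ≤ p.1} with hT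
  have hTm : MeasurableSet T := by
    have hm₁ : MeasurableSet {p : ℝ × (Fin 3 → ℝ) | p.1 ^ 2 + ∑ i, p.2 i ^ 2 ≤ r₂ ^ 2} :=
      measurableSet_le (by fun_prop) (by fun_prop)
    have hm₂ : MeasurableSet {p : ℝ × (Fin 3 → ℝ) | r₁ ≤ p.1} :=
      measurableSet_le (by fun_prop) (by fun_prop)
    exact hm₁.inter hm₂
  have hmp := (MeasureTheory.volume_preserving_piFinSuccAbove (fun _ : Fin 4 => ℝ) 3).comp
    (PiLp.volume_preserving_ofLp (Fin 4))
  have hpre : {y : EuclideanSpace ℝ (Fin 4) | ‖y‖ ≤ r₂ ∧ r₁ ≤ y 3}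
      = (MeasurableEquiv.piFinSuccAbove (fun _ : Fin 4 => ℝ) 3 ∘ WithLp.ofLp) ⁻¹' T := by
    ext y
    change ‖y‖ ≤ r₂ ∧ r₁ ≤ y 3 ↔
      y 3 ^ 2 + ∑ i : Fin 3, y (Fin.succAbove 3 i) ^ 2 ≤ r₂ ^ 2 ∧ r₁ ≤ y 3
    rw [EuclideanSpace.norm_eq, Real.sqrt_le_left hr₂, Fin.sum_univ_succAbove _ (3 : Fin 4)]
    simp only [Real.norm_eq_abs, sq_abs]
  have hslice (t : ℝ) : MeasureTheory.volume (Prod.mk t ⁻¹' T)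
      = (Set.Icc r₁ r₂).indicator
          (fun t => ENNReal.ofReal (4 * π / 3 * √(r₂ ^ 2 - t ^ 2) ^ 3)) t := by
    by_cases ht : t ∈ Set.Icc r₁ r₂
    · rw [Set.indicator_of_mem ht, ← volume_sum_sq_le_fin_three (by nlinarith [ht.1, ht.2])]
      congr 1
      ext x
      simp [hT, ht.1, le_sub_iff_add_le']
    · rw [Set.indicator_of_notMem ht]
      convert MeasureTheory.measure_empty (μ := MeasureTheory.volume)
      refine Set.eq_empty_of_forall_notMem fun x hx => ht ⟨hx.2, ?_⟩
      have hsum : 0 ≤ ∑ i, x i ^ 2 := Finset.sum_nonneg fun i _ => sq_nonneg _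
      exact abs_le_of_sq_le_sq' (by linarith [hx.1]) hr₂ |>.2
  rw [hpre, hmp.measure_preimage hTm.nullMeasurableSet, MeasureTheory.Measure.volume_eq_prod,
    MeasureTheory.Measure.prod_apply hTm, MeasureTheory.lintegral_congr hslice,
    MeasureTheory.lintegral_indicator measurableSet_Icc, intervalIntegral.integral_of_le h12,
    ← MeasureTheory.integral_Icc_eq_integral_Ioc,
    MeasureTheory.ofReal_integral_eq_lintegral_ofReal]
  · exact ContinuousOn.integrableOn_Icc (by fun_prop)
  · exact Filter.Eventually.of_forall fun t => by positivity

lemma integral_sin_pow_four_zero (φ : ℝ) :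
    ∫ θ in 0..φ, Real.sin θ ^ 4
      = (12 * φ - 8 * Real.sin (2 * φ) + Real.sin (4 * φ)) / 32 := by
  have h4 : Real.sin (4 * φ) = 2 * Real.sin (2 * φ) * Real.cos (2 * φ) := by
    rw [← Real.sin_two_mul]; ring_nf
  rw [integral_sin_pow, integral_sin_sq, h4, Real.sin_two_mul, Real.cos_two_mul']
  norm_num
  linear_combination (-Real.sin φ * Real.cos φ / 8) * Real.sin_sq_add_cos_sq φ

lemma integral_sqrt_sq_sub_sq_pow_three {r φ : ℝ} (hr : 0 ≤ r) (hφ₀ : 0 ≤ φ) (hφ : φ ≤ π) :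
    ∫ t in (r * Real.cos φ)..r, √(r ^ 2 - t ^ 2) ^ 3
      = r ^ 4 * ∫ θ in 0..φ, Real.sin θ ^ 4 := by
  have hsubst := intervalIntegral.integral_comp_mul_deriv (a := φ) (b := 0)
    (f := fun θ => r * Real.cos θ) (f' := fun θ => r * -Real.sin θ)
    (g := fun t => √(r ^ 2 - t ^ 2) ^ 3)
    (fun θ _ => (Real.hasDerivAt_cos θ).const_mul r) (by fun_prop) (by fun_prop)
  simp only [Real.cos_zero, mul_one] at hsubst
  rw [← hsubst, intervalIntegral.integral_symm, ← intervalIntegral.integral_neg,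
    ← intervalIntegral.integral_const_mul]
  refine intervalIntegral.integral_congr fun θ hθ => ?_
  rw [Set.uIcc_of_le hφ₀] at hθ
  have hsin : 0 ≤ Real.sin θ := Real.sin_nonneg_of_nonneg_of_le_pi hθ.1 (hθ.2.trans hφ)
  have hsqrt : √(r ^ 2 - (r * Real.cos θ) ^ 2) = r * Real.sin θ := by
    rw [← Real.sqrt_sq (mul_nonneg hr hsin)]
    congr 1
    linear_combination -r ^ 2 * Real.sin_sq_add_cos_sq θ
  simp only [Function.comp_apply, hsqrt]
  ring

theorem volume_hyperspherical_cap (r₁ r₂ : ℝ) (h0 : 0 ≤ r₁) (h12 : r₁ ≤ r₂) (h2 : 0 < r₂)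
    (φ : ℝ) (hφ : φ = Real.arccos (r₁ / r₂)) :
    MeasureTheory.volume {y : EuclideanSpace ℝ (Fin 4) | ‖y‖ ≤ r₂ ∧ r₁ ≤ y 3}
      = ENNReal.ofReal
          (π * r₂ ^ 4 / 24 * (12 * φ - 8 * Real.sin (2 * φ) + Real.sin (4 * φ))) := by
  have hcos : r₁ = r₂ * Real.cos φ := by
    rw [hφ, Real.cos_arccos (by linarith [div_nonneg h0 h2.le]) ((div_le_one h2).2 h12)]
    field_simp
  have hint := integral_sqrt_sq_sub_sq_pow_three h2.le
    (hφ ▸ Real.arccos_nonneg _) (hφ ▸ Real.arccos_le_pi _)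
  rw [← hcos, integral_sin_pow_four_zero] at hint
  rw [volume_cap_eq_integral h0 h12, intervalIntegral.integral_const_mul, hint]
  ring_nf
end

section
/- Let θ ∈ ℝ, let V be a 3×3 unitary complex matrix, and let ε, ε₁, ε₂, ε₃ be nonnegative reals with ε₁² + ε₂² + ε₃² ≤ ε². If Re(V₁₁ e^{iθ/2}) ≥ 1 − ε₁²/2, Re(V₂₂ e^{−iθ/2}) ≥ 1 − ε₂²/2, and Re(V₃₃) ≥ 1 − ε₃²/2 (where V_{jj} denotes the j-th diagonal entry of V), then ‖Diag(e^{−iθ/2}, e^{iθ/2}, 1) − V‖_F ≤ ε. -/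
/-- The rows of a unitary matrix have norm one. -/
theorem Matrix.sum_norm_sq_row_of_mem_unitaryGroup {n : Type*} [Fintype n] [DecidableEq n]
    {V : Matrix n n ℂ} (hV : V ∈ Matrix.unitaryGroup n ℂ) (i : n) :
    ∑ j, ‖V i j‖ ^ 2 = 1 := by
  have h := congrFun (congrFun (Matrix.mem_unitaryGroup_iff.mp hV) i) i
  simp only [Matrix.mul_apply, Matrix.star_apply, Matrix.one_apply_eq, RCLike.star_def,
    Complex.mul_conj'] at h
  exact_mod_cast h

theorem Complex.norm_sub_sq_eq_of_norm_eq_one {d : ℂ} (hd : ‖d‖ = 1) (z : ℂ) :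
    ‖d - z‖ ^ 2 = 1 + ‖z‖ ^ 2 - 2 * (z * star d).re := by
  have h : Complex.normSq d = 1 := by rw [Complex.normSq_eq_norm_sq, hd, one_pow]
  rw [← Complex.normSq_eq_norm_sq, ← Complex.normSq_eq_norm_sq, Complex.normSq_sub, h,
    ← Complex.conj_re (d * _), map_mul, Complex.conj_conj, mul_comm z]
  rfl

/-- The squared Frobenius distance from a diagonal unitary matrix to a unitary matrix depends only
on the diagonal entries. -/
theorem Matrix.sum_norm_sq_diagonal_sub_of_mem_unitaryGroup {n : Type*} [Fintype n] [DecidableEq n]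
    {V : Matrix n n ℂ} (hV : V ∈ Matrix.unitaryGroup n ℂ) {d : n → ℂ} (hd : ∀ i, ‖d i‖ = 1) :
    ∑ i, ∑ j, ‖(Matrix.diagonal d - V) i j‖ ^ 2 = ∑ i, (2 - 2 * (V i i * star (d i)).re) := by
  refine Finset.sum_congr rfl fun i _ => ?_
  have hrow := Matrix.sum_norm_sq_row_of_mem_unitaryGroup hV i
  rw [← Finset.add_sum_erase _ _ (Finset.mem_univ i)] at hrow ⊢
  have hoff : ∑ j ∈ Finset.univ.erase i, ‖(Matrix.diagonal d - V) i j‖ ^ 2 =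
      ∑ j ∈ Finset.univ.erase i, ‖V i j‖ ^ 2 :=
    Finset.sum_congr rfl fun j hj => by
      rw [Matrix.sub_apply, Matrix.diagonal_apply_ne' _ (Finset.ne_of_mem_erase hj), zero_sub,
        norm_neg]
  rw [hoff, Matrix.sub_apply, Matrix.diagonal_apply_eq,
    Complex.norm_sub_sq_eq_of_norm_eq_one (hd i)]
  linarith

theorem diag_conditions_suffice (θ : ℝ) (V : Matrix (Fin 3) (Fin 3) ℂ)
    (hV : V ∈ Matrix.unitaryGroup (Fin 3) ℂ)
    (ε ε₁ ε₂ ε₃ : ℝ) (hε : 0 ≤ ε) (hε₁ : 0 ≤ ε₁) (hε₂ : 0 ≤ ε₂) (hε₃ : 0 ≤ ε₃)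
    (hsum : ε₁ ^ 2 + ε₂ ^ 2 + ε₃ ^ 2 ≤ ε ^ 2)
    (h1 : 1 - ε₁ ^ 2 / 2 ≤ (V 0 0 * Complex.exp (Complex.I * θ / 2)).re)
    (h2 : 1 - ε₂ ^ 2 / 2 ≤ (V 1 1 * Complex.exp (-(Complex.I * θ / 2))).re)
    (h3 : 1 - ε₃ ^ 2 / 2 ≤ (V 2 2).re) :
    frobNorm
        (Matrix.diagonal
            ![Complex.exp (-(Complex.I * θ / 2)), Complex.exp (Complex.I * θ / 2), 1] - V)
      ≤ ε := by
  have hexp : ‖Complex.exp (Complex.I * θ / 2)‖ = 1 := by simp [Complex.norm_exp]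
  have hexp' : ‖Complex.exp (-(Complex.I * θ / 2))‖ = 1 := by simp [Complex.norm_exp]
  have hstar : star (Complex.exp (-(Complex.I * θ / 2))) = Complex.exp (Complex.I * θ / 2) := by
    rw [RCLike.star_def, ← Complex.exp_conj]
    simp [Complex.conj_ofNat, ← neg_div]
  have hstar' : star (Complex.exp (Complex.I * θ / 2)) = Complex.exp (-(Complex.I * θ / 2)) := by
    rw [← hstar, star_star]
  refine Real.sqrt_le_iff.mpr ⟨hε, ?_⟩
  rw [Matrix.sum_norm_sq_diagonal_sub_of_mem_unitaryGroup hV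
    (by simp [Fin.forall_fin_succ, hexp, hexp'])]
  simp only [Fin.sum_univ_three, Matrix.cons_val, hstar, hstar', star_one, mul_one]
  linarith
end
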